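/- arXiv:1705.10704 — 3 statements merged into one kernel-verified Lean document; each statement's English description precedes it below -/
import Mathlib

section
/- Let T be an n×n complex matrix that is power bounded by C with minimal polynomial m(z) = ∏_{i=1}^d (z−λ_i). Then for every ζ ∈ ℂ with |ζ| = 1 that is not a root of m, the matrix ζI − T is invertible and ‖(ζI − T)⁻¹‖ ≤ (3/2)·C·√(e² − 1) · d / min_{1≤i≤d} |ζ − λ_i|, where e is Euler's number. -/
theorem sum_normSq_sub_le (μ : ℂ) (hμ : ‖μ‖ ≤ 1) (e : ℕ → ℂ) (N : ℕ) :
    ∑ k ∈ Finset.range N, ‖e k - μ * e (k + 1)‖ ^ 2 ≤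
      ∑ k ∈ Finset.range N, ‖e (k + 1) - star μ * e k‖ ^ 2 + (1 - ‖μ‖ ^ 2) * ‖e 0‖ ^ 2 := by
  have key : ∑ k ∈ Finset.range N, ‖e k - μ * e (k + 1)‖ ^ 2 =
      ∑ k ∈ Finset.range N, ‖e (k + 1) - star μ * e k‖ ^ 2 +
        (1 - ‖μ‖ ^ 2) * (‖e 0‖ ^ 2 - ‖e N‖ ^ 2) := by
    induction N with
    | zero => simp
    | succ N ih =>
      have h : ‖e N - μ * e (N + 1)‖ ^ 2 = ‖e (N + 1) - star μ * e N‖ ^ 2 +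
          (1 - ‖μ‖ ^ 2) * (‖e N‖ ^ 2 - ‖e (N + 1)‖ ^ 2) := by
        simp only [← Complex.normSq_eq_norm_sq, Complex.normSq_apply, Complex.sub_re,
          Complex.sub_im, Complex.mul_re, Complex.mul_im, Complex.star_def, Complex.conj_re,
          Complex.conj_im]
        ring
      rw [Finset.sum_range_succ, Finset.sum_range_succ, ih, h]
      ring
  have : 0 ≤ (1 - ‖μ‖ ^ 2) * ‖e N‖ ^ 2 :=
    mul_nonneg (by nlinarith [norm_nonneg μ]) (by positivity)
  linarith

/-- The geometric power series is the inverse of `1 - r X`. -/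
theorem one_sub_C_mul_X_mul_mk_pow (r : ℂ) :
    (1 - PowerSeries.C r * PowerSeries.X) * PowerSeries.mk (fun k => r ^ k) = 1 := by
  ext k
  rw [sub_mul, one_mul, mul_assoc, map_sub, PowerSeries.coeff_C_mul]
  cases k with
  | zero => simp
  | succ k => simp [PowerSeries.coeff_succ_X_mul, pow_succ', PowerSeries.coeff_one]

theorem exists_coeff_mul_mk_pow_le {r : ℂ} (hr : ‖r‖ < 1) {Q : PowerSeries ℂ} {M : ℝ}
    (hQ : ∀ k, ‖PowerSeries.coeff k Q‖ ≤ M) (k : ℕ) :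
    ‖PowerSeries.coeff k (Q * PowerSeries.mk fun k => r ^ k)‖ ≤ M / (1 - ‖r‖) := by
  set H := Q * PowerSeries.mk fun k => r ^ k with hH
  have hM : 0 ≤ M := (norm_nonneg _).trans (hQ 0)
  have h1 : 0 < 1 - ‖r‖ := by linarith
  have h2 : H = Q + PowerSeries.C r * (PowerSeries.X * H) := by
    linear_combination Q * one_sub_C_mul_X_mul_mk_pow r + (1 - PowerSeries.C r * PowerSeries.X) * hH
  rw [le_div_iff₀ h1]
  induction k with
  | zero =>
    rw [h2]
    simp only [map_add, PowerSeries.coeff_C_mul, PowerSeries.coeff_zero_X_mul, mul_zero, add_zero]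
    nlinarith [hQ 0, norm_nonneg r, norm_nonneg (PowerSeries.coeff 0 Q)]
  | succ k ih =>
    rw [h2]
    simp only [map_add, PowerSeries.coeff_C_mul, PowerSeries.coeff_succ_X_mul]
    have := norm_add_le (PowerSeries.coeff (k + 1) Q) (r * PowerSeries.coeff k H)
    rw [norm_mul] at this
    nlinarith [hQ (k + 1), norm_nonneg r, mul_le_mul_of_nonneg_left ih (norm_nonneg r)]

/-- A finite Blaschke product `B` with zeros `μ i`, written as
`B = B(w) + (X - w) G` with an `ℓ²` bound on the coefficients of `G`. -/
theorem exists_blaschke_decomposition {ι : Type*} (s : Finset ι) (μ : ι → ℂ)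
    (hμ : ∀ i, ‖μ i‖ < 1) (w : ℂ) (hw : ‖w‖ < 1) :
    ∃ Q G : PowerSeries ℂ,
      ((∏ i ∈ s, (Polynomial.X - Polynomial.C (μ i)) : Polynomial ℂ) : PowerSeries ℂ) * Q =
        PowerSeries.C (∏ i ∈ s, (w - μ i) / (1 - star (μ i) * w)) +
          (PowerSeries.X - PowerSeries.C w) * G ∧
      (∃ M, ∀ k, ‖PowerSeries.coeff k Q‖ ≤ M) ∧
      ∀ N, ∑ k ∈ Finset.range N, ‖PowerSeries.coeff k G‖ ^ 2 ≤
        (1 - ‖∏ i ∈ s, (w - μ i) / (1 - star (μ i) * w)‖ ^ 2) / (1 - ‖w‖ ^ 2) := by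
  classical
  induction s using Finset.induction_on with
  | empty =>
    refine ⟨1, 0, by simp, ⟨1, fun k => ?_⟩, by simp⟩
    rw [PowerSeries.coeff_one]
    split_ifs <;> simp
  | insert i s hi ih =>
    obtain ⟨Q, G, hQG, ⟨M, hM⟩, hG⟩ := ih
    rw [Finset.prod_insert hi, Finset.prod_insert hi]
    set c := ∏ i ∈ s, (w - μ i) / (1 - star (μ i) * w)
    set ν := μ i
    have hν1 : ‖ν‖ < 1 := hμ i
    have hνs : ‖star ν‖ < 1 := by simpa using hν1
    have hne : 1 - star ν * w ≠ 0 := by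
      intro h
      have h1 : ‖star ν * w‖ = 1 := by rw [← sub_eq_zero.mp h]; simp
      rw [norm_mul] at h1
      nlinarith [norm_nonneg w, norm_nonneg (star ν)]
    have hww : 0 < 1 - ‖w‖ ^ 2 := by nlinarith [norm_nonneg w]
    set K : PowerSeries ℂ := PowerSeries.mk fun k => (star ν) ^ k with hK
    have hK1 := one_sub_C_mul_X_mul_mk_pow (star ν)
    rw [← hK] at hK1
    set H := G * K with hH
    have hGH : G = H - PowerSeries.C (star ν) * (PowerSeries.X * H) := by
      rw [hH]; linear_combination (-G) * hK1
    set m := c / (1 - star ν * w) with hm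
    refine ⟨Q * K, (PowerSeries.X - PowerSeries.C ν) * H +
      PowerSeries.C (m * (1 - ν * star ν)) * K, ?_, ⟨_, exists_coeff_mul_mk_pow_le hνs hM⟩, ?_⟩
    · have hc : c = m * (1 - star ν * w) := by rw [hm]; field_simp
      have hc' : (w - ν) / (1 - star ν * w) * c = m * (w - ν) := by rw [hm]; field_simp
      rw [hc', Polynomial.coe_mul, Polynomial.coe_sub, Polynomial.coe_X, Polynomial.coe_C]
      rw [hc] at hQG
      simp only [map_mul, map_sub, map_one] at hQG ⊢
      linear_combination (PowerSeries.X - PowerSeries.C ν) * K * hQG +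
        (PowerSeries.C m * (PowerSeries.C w - PowerSeries.C ν)) * hK1
    · intro N
      set e : ℕ → ℂ := fun k => PowerSeries.coeff k (PowerSeries.X * H + PowerSeries.C m * K)
        with he
      have hek : ∀ k, e k = PowerSeries.coeff k (PowerSeries.X * H) + m * star ν ^ k := by
        intro k; simp [he, hK]
      have hek' : ∀ k, e (k + 1) = PowerSeries.coeff k H + m * star ν ^ (k + 1) := by
        intro k; rw [hek, PowerSeries.coeff_succ_X_mul]
      have h := sum_normSq_sub_le ν hν1.le e N
      have h1 : ∀ k, e k - ν * e (k + 1) = PowerSeries.coeff k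
          ((PowerSeries.X - PowerSeries.C ν) * H + PowerSeries.C (m * (1 - ν * star ν)) * K) := by
        intro k
        rw [hek, hek', sub_mul, map_add, map_sub, PowerSeries.coeff_C_mul,
          PowerSeries.coeff_C_mul, hK, PowerSeries.coeff_mk]
        ring
      have h2 : ∀ k, e (k + 1) - star ν * e k = PowerSeries.coeff k G := by
        intro k
        rw [hek', hek, hGH, map_sub, PowerSeries.coeff_C_mul]
        ring
      have h0 : e 0 = m := by rw [hek]; simp
      simp only [h1, h2, h0] at h
      refine h.trans ((add_le_add_left (hG N) _).trans (le_of_eq ?_))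
      have hn : ‖1 - star ν * w‖ ^ 2 ≠ 0 := by positivity
      have hid : ‖w - ν‖ ^ 2 = ‖1 - star ν * w‖ ^ 2 - (1 - ‖w‖ ^ 2) * (1 - ‖ν‖ ^ 2) := by
        simp only [← Complex.normSq_eq_norm_sq, Complex.normSq_apply, Complex.sub_re,
          Complex.sub_im, Complex.mul_re, Complex.mul_im, Complex.star_def, Complex.conj_re,
          Complex.conj_im, Complex.one_re, Complex.one_im]
        ring
      rw [hm, norm_mul, norm_div, norm_div, mul_pow, div_pow, div_pow, hid]
      field_simp
      ring

theorem hasSum_coeff_polynomial_mul {R : Type*} [NormedRing R] [NormedAlgebra ℂ R] {A x : R}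
    {F : PowerSeries ℂ} (hF : HasSum (fun k => PowerSeries.coeff k F • A ^ k) x)
    (p : Polynomial ℂ) :
    HasSum (fun k => PowerSeries.coeff k ((p : PowerSeries ℂ) * F) • A ^ k)
      (Polynomial.aeval A p * x) := by
  induction p using Polynomial.induction_on with
  | C c =>
    simpa [mul_smul, Algebra.algebraMap_eq_smul_one] using hF.const_smul c
  | add p q hp hq =>
    simpa [add_mul, add_smul] using hp.add hq
  | monomial n c h =>
    have e : ((Polynomial.C c * Polynomial.X ^ (n + 1) : Polynomial ℂ) : PowerSeries ℂ) * F =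
        PowerSeries.X * (((Polynomial.C c * Polynomial.X ^ n : Polynomial ℂ) :
          PowerSeries ℂ) * F) := by
      simp only [Polynomial.coe_mul, Polynomial.coe_pow, Polynomial.coe_X]
      ring
    have e' : Polynomial.aeval A (Polynomial.C c * Polynomial.X ^ (n + 1) : Polynomial ℂ) =
        A * Polynomial.aeval A (Polynomial.C c * Polynomial.X ^ n : Polynomial ℂ) := by
      simp [pow_succ', Algebra.algebraMap_eq_smul_one]
    rw [e, e', mul_assoc, ← hasSum_nat_add_iff' 1]
    simpa [PowerSeries.coeff_succ_X_mul, pow_succ'] using h.mul_left A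

theorem HasSum.norm_le_of_coeff_sq_sum_le {R : Type*} [NormedRing R] [NormedAlgebra ℂ R]
    {A x : R} {g : ℕ → ℂ} {C a L : ℝ} (ha0 : 0 ≤ a) (ha1 : a < 1)
    (hA : ∀ k, ‖A ^ k‖ ≤ C * a ^ k)
    (hg : ∀ N, ∑ k ∈ Finset.range N, ‖g k‖ ^ 2 ≤ L)
    (hx : HasSum (fun k => g k • A ^ k) x) :
    ‖x‖ ≤ C * √(L / (1 - a ^ 2)) := by
  have hC : 0 ≤ C := by simpa using (norm_nonneg _).trans (hA 0)
  have hL : 0 ≤ L := by simpa using hg 0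
  refine le_of_tendsto hx.tendsto_sum_nat.norm (Filter.Eventually.of_forall fun N => ?_)
  have hgeo : ∑ k ∈ Finset.range N, (a ^ k) ^ 2 ≤ 1 / (1 - a ^ 2) := by
    have h := (summable_geometric_of_lt_one (sq_nonneg a) (by nlinarith)).sum_le_tsum
      (Finset.range N) (fun k _ => by positivity)
    rw [tsum_geometric_of_lt_one (sq_nonneg a) (by nlinarith)] at h
    simpa [← pow_mul, mul_comm] using h
  have hcs : ∑ k ∈ Finset.range N, ‖g k‖ * a ^ k ≤ √(L / (1 - a ^ 2)) := by
    refine Real.le_sqrt_of_sq_le ((Finset.sum_mul_sq_le_sq_mul_sq _ _ _).trans ?_)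
    rw [div_eq_mul_one_div]
    exact mul_le_mul (hg N) hgeo (by positivity) hL
  calc ‖∑ k ∈ Finset.range N, g k • A ^ k‖
      ≤ ∑ k ∈ Finset.range N, C * (‖g k‖ * a ^ k) := by
        refine norm_sum_le_of_le _ fun k _ => ?_
        rw [norm_smul]
        nlinarith [mul_le_mul_of_nonneg_left (hA k) (norm_nonneg (g k))]
    _ ≤ C * √(L / (1 - a ^ 2)) := by
        rw [← Finset.mul_sum]; gcongr

theorem summable_smul_pow_of_coeff_le {R : Type*} [NormedRing R] [NormedAlgebra ℂ R]
    [CompleteSpace R] {A : R} {g : ℕ → ℂ} {C a M : ℝ} (ha0 : 0 ≤ a) (ha1 : a < 1)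
    (hA : ∀ k, ‖A ^ k‖ ≤ C * a ^ k) (hg : ∀ k, ‖g k‖ ≤ M) :
    Summable (fun k => g k • A ^ k) := by
  have hM : 0 ≤ M := (norm_nonneg _).trans (hg 0)
  refine Summable.of_norm_bounded
    ((summable_geometric_of_lt_one ha0 ha1).mul_left (M * C)) fun k => ?_
  rw [norm_smul, mul_assoc]
  exact mul_le_mul (hg k) (hA k) (norm_nonneg _) hM

theorem norm_le_one_of_mem_spectrum_of_power_bounded {R : Type*} [NormedRing R]
    [NormedAlgebra ℂ R] [CompleteSpace R] {T : R} {C : ℝ} (hpb : ∀ j : ℕ, ‖T ^ j‖ ≤ C)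
    {z : ℂ} (hz : z ∈ spectrum ℂ T) : ‖z‖ ≤ 1 := by
  by_contra! h
  obtain ⟨j, hj⟩ := pow_unbounded_of_one_lt (C * ‖(1 : R)‖) h
  have h1 := spectrum.norm_le_norm_mul_of_mem (spectrum.pow_mem_pow T j hz)
  rw [norm_pow] at h1
  have := mul_le_mul_of_nonneg_right (hpb j) (norm_nonneg (1 : R))
  linarith

theorem mem_spectrum_of_isRoot_minpoly {K R : Type*} [Field K] [Ring R] [Algebra K R] {T : R}
    (hT : IsIntegral K T) {z : K} (hz : (minpoly K T).IsRoot z) : z ∈ spectrum K T := by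
  rw [spectrum.mem_iff]
  intro hu
  obtain ⟨q, hq⟩ := Polynomial.dvd_iff_isRoot.mpr hz
  have hne := minpoly.ne_zero hT
  have hq0 : q ≠ 0 := by rintro rfl; simp [hq] at hne
  have h0 := minpoly.aeval K T
  rw [hq, map_mul, map_sub, Polynomial.aeval_X, Polynomial.aeval_C, ← neg_sub, neg_mul,
    neg_eq_zero] at h0
  have h1 : Polynomial.aeval T q = 0 := hu.mul_right_eq_zero.mp h0
  have h2 := Polynomial.natDegree_le_of_dvd (minpoly.dvd K T h1) hq0
  have h3 : (minpoly K T).natDegree = 1 + q.natDegree := by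
    rw [hq, Polynomial.natDegree_mul (Polynomial.X_sub_C_ne_zero z) hq0,
      Polynomial.natDegree_X_sub_C]
  omega

/-- For `a` close to `1` relative to the distance from `ζ` to `lam`, the modulus at `a ζ`
of the Blaschke factor with zero `a lam` is close to `1`. -/
theorem le_norm_blaschke_factor {a t : ℝ} (ha0 : 0 < a) (ha1 : a < 1) {ζ lam : ℂ}
    (hζ : ‖ζ‖ = 1) (hlam : ‖lam‖ ≤ 1) (hne : ζ ≠ lam) (ht : 1 - a ^ 2 ≤ a * ‖ζ - lam‖ * t) :
    Real.exp (-t) ≤ ‖(a * ζ - a * lam) / (1 - star (a * lam) * (a * ζ))‖ := by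
  have hD : 0 < ‖ζ - lam‖ := norm_pos_iff.mpr (sub_ne_zero.mpr hne)
  have hid : ‖1 - star (a * lam) * (a * ζ)‖ ^ 2 =
      (1 - a ^ 2) * (1 - a ^ 2 * ‖lam‖ ^ 2) + a ^ 2 * ‖ζ - lam‖ ^ 2 := by
    have h1 : ‖ζ‖ ^ 2 = 1 := by rw [hζ]; norm_num
    simp only [← Complex.normSq_eq_norm_sq, Complex.normSq_apply, Complex.sub_re,
      Complex.sub_im, Complex.mul_re, Complex.mul_im, Complex.star_def, Complex.conj_re,
      Complex.conj_im, Complex.one_re, Complex.one_im, Complex.ofReal_re,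
      Complex.ofReal_im] at h1 ⊢
    linear_combination (a ^ 4 * (lam.re * lam.re + lam.im * lam.im) - a ^ 2) * h1
  have htri : 1 ≤ ‖ζ - lam‖ + ‖lam‖ := by
    have := norm_add_le (ζ - lam) lam
    rwa [sub_add_cancel, hζ] at this
  have hden : ‖1 - star (a * lam) * (a * ζ)‖ ≤ a * ‖ζ - lam‖ + (1 - a ^ 2) := by
    have h1 : 0 < 1 - a ^ 2 := by nlinarith
    have h2 : a * (1 - ‖lam‖ ^ 2) ≤ 2 * ‖ζ - lam‖ := by
      have h3 : 0 ≤ 1 - ‖lam‖ ^ 2 := by nlinarith [norm_nonneg lam]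
      nlinarith [norm_nonneg lam, mul_nonneg (sub_nonneg.mpr ha1.le) h3]
    refine (sq_le_sq₀ (norm_nonneg _) (by positivity)).mp ?_
    rw [hid]
    nlinarith [mul_le_mul_of_nonneg_left h2 (mul_pos h1 ha0).le]
  have hpos : 0 < ‖1 - star (a * lam) * (a * ζ)‖ := by
    have h1 : 0 < 1 - a ^ 2 := by nlinarith
    have h2 : 0 ≤ 1 - a ^ 2 * ‖lam‖ ^ 2 := by
      have := pow_le_one₀ (n := 2) (norm_nonneg lam) hlam
      nlinarith
    refine (sq_pos_iff.mp ?_).lt_of_le' (norm_nonneg _)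
    rw [hid]
    positivity
  rw [norm_div, ← mul_sub, norm_mul, Complex.norm_real, Real.norm_of_nonneg ha0.le,
    le_div_iff₀ hpos, Real.exp_neg, inv_mul_le_iff₀ (Real.exp_pos t)]
  nlinarith [Real.add_one_le_exp t, mul_pos ha0 hD]

/-- A scaling parameter `a < 1` adapted to the ratio `δ / d`. -/
theorem exists_scaling_parameter {δ d : ℝ} (hδ0 : 0 < δ) (hδ2 : δ ≤ 2) (hd : 1 ≤ d) :
    ∃ a : ℝ, 0 < a ∧ a < 1 ∧ 1 - a ^ 2 ≤ a * δ * (1 / d) ∧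
      a / (1 - a ^ 2) ≤ 3 / 2 * d / δ := by
  obtain ⟨s, hs⟩ : ∃ s, s = δ / (2 * d) := ⟨_, rfl⟩
  have hd0 : 0 < d := by linarith
  have hs0 : 0 < s := by rw [hs]; positivity
  have hs1 : s ≤ 1 := by rw [hs, div_le_one (by positivity)]; linarith
  have hδ : δ = 2 * d * s := by rw [hs]; field_simp
  have ha1 : 1 / (1 + s) < 1 := by rw [div_lt_one (by positivity)]; linarith
  refine ⟨1 / (1 + s), by positivity, ha1, ?_, ?_⟩
  · have e : 1 / (1 + s) * δ * (1 / d) - (1 - (1 / (1 + s)) ^ 2) = s ^ 2 / (1 + s) ^ 2 := by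
      rw [hδ]; field_simp; ring
    have : 0 ≤ s ^ 2 / (1 + s) ^ 2 := by positivity
    linarith
  · have e : 1 / (1 + s) / (1 - (1 / (1 + s)) ^ 2) = (1 + s) / (s * (2 + s)) := by
      have : (1 + s) ^ 2 - 1 ≠ 0 := by nlinarith
      field_simp
      ring
    have e' : 3 / 2 * d / δ = 3 / (4 * s) := by rw [hδ]; field_simp; norm_num
    rw [e, e', div_le_div_iff₀ (by positivity) (by positivity)]
    nlinarith

/-- If T is power bounded by C with minimal polynomial ∏_{i=1}^d (z−λ_i) and
ζ lies on the unit circle and is not a root of the minimal polynomial, then ζI − T is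
invertible and ‖(ζI−T)⁻¹‖ ≤ (3/2)·C·√(e²−1)·d / min_i |ζ − λ_i|. -/
theorem resolvent_bound_boundary_point
    {E : Type*} [NormedAddCommGroup E] [NormedSpace ℂ E] [FiniteDimensional ℂ E]
    (n : ℕ) (hn : 1 ≤ n) (hdim : Module.finrank ℂ E = n)
    (T : E →L[ℂ] E) (C : ℝ) (hC : 1 ≤ C) (hpb : ∀ j : ℕ, ‖T ^ j‖ ≤ C)
    (d : ℕ) (hd : 0 < d) (lam : Fin d → ℂ)
    (hmin : minpoly ℂ T = ∏ i : Fin d, (Polynomial.X - Polynomial.C (lam i)))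
    (ζ : ℂ) (hζ : ‖ζ‖ = 1) (hζroot : ∀ i, ζ ≠ lam i) :
    ∃ S : E →L[ℂ] E, (ζ • 1 - T) * S = 1 ∧ S * (ζ • 1 - T) = 1 ∧
      ‖S‖ ≤ 3 / 2 * C * Real.sqrt (Real.exp 1 ^ 2 - 1) * d /
        Finset.inf' Finset.univ (Finset.univ_nonempty_iff.mpr ⟨⟨0, hd⟩⟩)
          (fun i => ‖ζ - lam i‖) := by
  have : Nontrivial E := Module.nontrivial_of_finrank_pos (R := ℂ) (by omega)
  set hne : (Finset.univ : Finset (Fin d)).Nonempty :=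
    Finset.univ_nonempty_iff.mpr ⟨⟨0, hd⟩⟩
  set δ := Finset.inf' Finset.univ hne (fun i => ‖ζ - lam i‖) with hδ
  have hδle : ∀ i, δ ≤ ‖ζ - lam i‖ := fun i => Finset.inf'_le _ (Finset.mem_univ i)
  have hlam : ∀ i, ‖lam i‖ ≤ 1 := fun i =>
    norm_le_one_of_mem_spectrum_of_power_bounded hpb
      (mem_spectrum_of_isRoot_minpoly (Algebra.IsIntegral.isIntegral T) (by
        rw [hmin, Polynomial.IsRoot, Polynomial.eval_prod]
        exact Finset.prod_eq_zero (Finset.mem_univ i) (by simp)))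
  have hδ0 : 0 < δ := by
    rw [hδ, Finset.lt_inf'_iff]
    exact fun i _ => norm_pos_iff.mpr (sub_ne_zero.mpr (hζroot i))
  have hδ2 : δ ≤ 2 := by
    have h1 := norm_sub_le ζ (lam ⟨0, hd⟩)
    have h2 := hδle ⟨0, hd⟩
    have h3 := hlam ⟨0, hd⟩
    linarith
  have hd1 : (1 : ℝ) ≤ d := by exact_mod_cast hd
  obtain ⟨a, ha0, ha1, hat, haδ⟩ := exists_scaling_parameter hδ0 hδ2 hd1
  have haa : 0 < 1 - a ^ 2 := by nlinarith
  have hnorm : ∀ z : ℂ, ‖z‖ ≤ 1 → ‖a * z‖ < 1 := fun z hz => by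
    rw [norm_mul, Complex.norm_real, Real.norm_of_nonneg ha0.le]
    nlinarith [norm_nonneg z]
  have hnormζ : ‖a * ζ‖ = a := by
    rw [norm_mul, Complex.norm_real, Real.norm_of_nonneg ha0.le, hζ, mul_one]
  obtain ⟨Q, G, hQG, ⟨M, hM⟩, hG⟩ := exists_blaschke_decomposition Finset.univ
    (fun i => a * lam i) (fun i => hnorm _ (hlam i)) (a * ζ) (hnorm _ hζ.le)
  set c := ∏ i, (a * ζ - a * lam i) / (1 - star (a * lam i) * (a * ζ)) with hc
  have hcexp : Real.exp (-1) ≤ ‖c‖ := by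
    rw [hc, norm_prod]
    calc Real.exp (-1) = ∏ _i : Fin d, Real.exp (-(1 / d)) := by
          rw [Finset.prod_const, Finset.card_univ, Fintype.card_fin, ← Real.exp_nat_mul]
          congr 1
          field_simp
      _ ≤ _ := Finset.prod_le_prod (fun _ _ => (Real.exp_pos _).le) fun i _ =>
          le_norm_blaschke_factor ha0 ha1 hζ (hlam i) (hζroot i) (hat.trans (by
            gcongr
            exact hδle i))
  have hc0 : 0 < ‖c‖ := (Real.exp_pos _).trans_le hcexp
  have hcne : c ≠ 0 := norm_pos_iff.mp hc0
  set A : E →L[ℂ] E := (a : ℂ) • T with hAdef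
  have hA : ∀ k, ‖A ^ k‖ ≤ C * a ^ k := fun k => by
    rw [hAdef, smul_pow, norm_smul, norm_pow, Complex.norm_real, Real.norm_of_nonneg ha0.le,
      mul_comm]
    gcongr
    exact hpb k
  have hG1 : ∀ k, ‖PowerSeries.coeff k G‖ ^ 2 ≤ (1 - ‖c‖ ^ 2) / (1 - ‖a * ζ‖ ^ 2) := fun k =>
    (Finset.single_le_sum (f := fun k => ‖PowerSeries.coeff k G‖ ^ 2)
      (fun _ _ => by positivity) (Finset.self_mem_range_succ k)).trans (hG (k + 1))
  obtain ⟨x, hx⟩ := summable_smul_pow_of_coeff_le ha0.le ha1 hA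
    (fun k => Real.le_sqrt_of_sq_le (hG1 k))
  obtain ⟨y, hy⟩ := summable_smul_pow_of_coeff_le ha0.le ha1 hA hM
  have hP0 : Polynomial.aeval A (∏ i, (Polynomial.X - Polynomial.C (a * lam i))) = 0 := by
    have h1 : (∏ i, (Polynomial.X - Polynomial.C (a * lam i))).comp
        (Polynomial.C (a : ℂ) * Polynomial.X) = Polynomial.C ((a : ℂ) ^ d) * minpoly ℂ T := by
      rw [hmin, Polynomial.prod_comp]
      simp [← mul_sub, Finset.prod_mul_distrib]
    have h2 := congrArg (Polynomial.aeval T) h1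
    rw [Polynomial.aeval_comp, map_mul (Polynomial.aeval T) (Polynomial.C _) (minpoly ℂ T),
      minpoly.aeval, mul_zero, map_mul, Polynomial.aeval_C, Polynomial.aeval_X,
      ← Algebra.smul_def] at h2
    exact h2
  have hval : c • (1 : E →L[ℂ] E) + (A - (a * ζ) • 1) * x = 0 := by
    have h1 := hasSum_coeff_polynomial_mul hy (∏ i, (Polynomial.X - Polynomial.C (a * lam i)))
    rw [hP0, zero_mul, hQG] at h1
    have h2 := hasSum_coeff_polynomial_mul hx (Polynomial.X - Polynomial.C (a * ζ))
    have h3 : HasSum (fun k => PowerSeries.coeff k (PowerSeries.C c) • A ^ k)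
        (c • (1 : E →L[ℂ] E)) := by
      convert hasSum_single (f := fun k => PowerSeries.coeff k (PowerSeries.C c) • A ^ k) 0
        (fun k hk => by simp [PowerSeries.coeff_C, hk]) using 1
      simp
    have h4 := h3.add h2
    simp only [← add_smul, ← map_add, Polynomial.coe_sub, Polynomial.coe_X,
      Polynomial.coe_C] at h4
    have h5 := h4.unique h1
    rwa [map_sub, Polynomial.aeval_X, Polynomial.aeval_C, Algebra.algebraMap_eq_smul_one] at h5
  have hright : (ζ • 1 - T) * (((a : ℂ) / c) • x) = 1 := by
    have h1 : (A - (a * ζ) • 1) * x = -((a : ℂ) • ((ζ • 1 - T) * x)) := by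
      rw [hAdef, mul_smul, ← smul_sub, smul_mul_assoc, ← smul_neg, ← neg_mul, neg_sub]
    rw [h1, ← sub_eq_add_neg, sub_eq_zero] at hval
    rw [mul_smul_comm, div_eq_inv_mul, mul_smul, ← hval, smul_smul, inv_mul_cancel₀ hcne, one_smul]
  refine ⟨((a : ℂ) / c) • x, hright, ?_, ?_⟩
  · have h1 : ((ζ • 1 - T : E →L[ℂ] E) : E →ₗ[ℂ] E) *
        ((((a : ℂ) / c) • x : E →L[ℂ] E) : E →ₗ[ℂ] E) = 1 :=
      congrArg ContinuousLinearMap.toLinearMap hright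
    have h2 := _root_.mul_eq_one_comm.mp h1
    ext v
    exact LinearMap.congr_fun h2 v
  · have hxn := HasSum.norm_le_of_coeff_sq_sum_le ha0.le ha1 hA hG hx
    rw [hnormζ, div_div, ← sq, Real.sqrt_div' _ (by positivity), Real.sqrt_sq haa.le] at hxn
    have hce : √(1 - ‖c‖ ^ 2) ≤ √(Real.exp 1 ^ 2 - 1) * ‖c‖ := by
      have h1 : 1 ≤ Real.exp 1 * ‖c‖ := by
        rwa [Real.exp_neg, inv_le_iff_one_le_mul₀' (Real.exp_pos 1)] at hcexp
      rw [← Real.sqrt_sq hc0.le, ← Real.sqrt_mul' _ (by positivity), Real.sqrt_sq hc0.le]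
      refine Real.sqrt_le_sqrt ?_
      nlinarith
    rw [norm_smul, norm_div, Complex.norm_real, Real.norm_of_nonneg ha0.le]
    calc a / ‖c‖ * ‖x‖
        ≤ a / ‖c‖ * (C * (√(Real.exp 1 ^ 2 - 1) * ‖c‖ / (1 - a ^ 2))) := by
          gcongr
          exact hxn.trans (by gcongr)
      _ = C * √(Real.exp 1 ^ 2 - 1) * (a / (1 - a ^ 2)) := by field_simp
      _ ≤ C * √(Real.exp 1 ^ 2 - 1) * (3 / 2 * d / δ) := by gcongr
      _ = 3 / 2 * C * √(Real.exp 1 ^ 2 - 1) * d / δ := by ring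
end

section
/- Fix λ ∈ (0,1) and set α₀ = (1−λ)/(1+λ). Then there exist a constant M > 0 and an integer N such that for all n ≥ N and every integer k with |k/n − α₀| ≤ n^{−2/3} or |k/n − α₀^{−1}| ≤ n^{−2/3}, one has |c_{n,k}| ≤ M · n^{−2/3}. -/
open Complex in
/-- **Cauchy's coefficient formula** on the unit circle, as a bound. -/
lemma norm_coeff_le_norm_integral {F : ℂ → ℂ} {a : ℕ → ℂ}
    (hF : DifferentiableOn ℂ F (Metric.closedBall 0 1))
    (ha : ∀ z : ℂ, ‖z‖ < 1 → HasSum (fun k => a k * z ^ k) (F z)) (k : ℕ) :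
    ‖a k‖ ≤ ‖∫ θ in (0 : ℝ)..2 * Real.pi, F (exp (θ * I)) * exp (-(k * (θ * I)))‖ := by
  have h1 : HasFPowerSeriesAt F (cauchyPowerSeries F 0 (1 : NNReal)) 0 :=
    (DifferentiableOn.hasFPowerSeriesOnBall (R := 1) (by simpa using hF)
      one_pos).hasFPowerSeriesAt
  have h2 : HasFPowerSeriesAt F (FormalMultilinearSeries.ofScalars ℂ a) 0 := by
    rw [hasFPowerSeriesAt_iff']
    filter_upwards [Metric.ball_mem_nhds (0 : ℂ) one_pos] with z hz
    have := ha z (by simpa using hz)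
    simpa [FormalMultilinearSeries.coeff_ofScalars, mul_comm] using this
  have h3 := h2.eq_formalMultilinearSeries h1
  have h4 : a k = (2 * Real.pi * I : ℂ)⁻¹ •
      ∮ z in C(0, 1), (1 / (z - 0)) ^ k • (z - 0)⁻¹ • F z := by
    have := cauchyPowerSeries_apply F 0 1 k 1
    rw [← this]
    have h5 := congrArg (fun p => p.coeff k) h3
    simp only [FormalMultilinearSeries.coeff_ofScalars] at h5
    rw [h5]
    rfl
  have h6 : (∮ z in C(0, 1), (1 / (z - 0)) ^ k • (z - 0)⁻¹ • F z) =
      I * ∫ θ in (0 : ℝ)..2 * Real.pi, F (exp (θ * I)) * exp (-(k * (θ * I))) := by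
    rw [circleIntegral, ← intervalIntegral.integral_const_mul]
    refine intervalIntegral.integral_congr fun θ _ => ?_
    have := exp_ne_zero (θ * I)
    simp only [deriv_circleMap, circleMap, smul_eq_mul, exp_neg, exp_nat_mul]
    simp
    field_simp
  rw [h4, h6, smul_eq_mul, norm_mul, norm_mul]
  simp only [norm_inv, norm_mul, norm_I, one_mul, mul_one, norm_real, Real.norm_eq_abs,
    abs_of_pos Real.pi_pos]
  refine mul_le_of_le_one_left (norm_nonneg _) (inv_le_one_of_one_le₀ ?_)
  have := Real.pi_gt_three
  norm_num
  linarith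

lemma div_pi_le_sin_half {δ θ : ℝ} (hδ : 0 ≤ δ) (h1 : δ ≤ θ) (h2 : θ ≤ 2 * Real.pi - δ) :
    δ / Real.pi ≤ Real.sin (θ / 2) := by
  have hπ := Real.pi_pos
  rcases le_total θ Real.pi with h | h
  · have := Real.mul_le_sin (x := θ / 2) (by linarith) (by linarith)
    refine le_trans ?_ this
    rw [div_le_iff₀ hπ]
    field_simp
    linarith
  · have := Real.mul_le_sin (x := Real.pi - θ / 2) (by linarith) (by linarith)
    rw [Real.sin_pi_sub] at this
    refine le_trans ?_ this
    rw [div_le_iff₀ hπ]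
    field_simp
    linarith

lemma integral_inv_sin_half_sq_le {δ : ℝ} (hδ : 0 < δ) (hδπ : δ ≤ Real.pi) :
    IntervalIntegrable (fun θ => 1 / Real.sin (θ / 2) ^ 2) MeasureTheory.volume
      δ (2 * Real.pi - δ) ∧
    ∫ θ in δ..2 * Real.pi - δ, 1 / Real.sin (θ / 2) ^ 2 ≤ 4 * Real.pi / δ := by
  have hs : ∀ θ ∈ Set.uIcc δ (2 * Real.pi - δ), 0 < Real.sin (θ / 2) := by
    intro θ hθ
    rw [Set.uIcc_of_le (by linarith)] at hθ
    exact (div_pos hδ Real.pi_pos).trans_le (div_pi_le_sin_half hδ.le hθ.1 hθ.2)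
  have hint : IntervalIntegrable (fun θ => 1 / Real.sin (θ / 2) ^ 2) MeasureTheory.volume
      δ (2 * Real.pi - δ) := by
    apply ContinuousOn.intervalIntegrable
    exact ContinuousOn.div (by fun_prop) (by fun_prop) fun θ hθ => (pow_pos (hs θ hθ) 2).ne'
  refine ⟨hint, ?_⟩
  rw [intervalIntegral.integral_eq_sub_of_hasDerivAt
    (f := fun θ => -2 * Real.cos (θ / 2) / Real.sin (θ / 2)) ?_ hint]
  · have e1 : (2 * Real.pi - δ) / 2 = Real.pi - δ / 2 := by ring
    simp only [e1, Real.sin_pi_sub, Real.cos_pi_sub]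
    have h := div_pi_le_sin_half (θ := δ) hδ.le le_rfl (by linarith)
    have h0 : 0 < δ / Real.pi := div_pos hδ Real.pi_pos
    calc _ = 4 * Real.cos (δ / 2) / Real.sin (δ / 2) := by ring
      _ ≤ 4 * 1 / (δ / Real.pi) := by
        gcongr
        exact Real.cos_le_one _
      _ = _ := by field_simp
  · intro θ hθ
    have hne := (hs θ hθ).ne'
    have hh : HasDerivAt (fun θ : ℝ => θ / 2) (1 / 2) θ := (hasDerivAt_id θ).div_const 2
    refine ((hh.cos.const_mul (-2)).div hh.sin hne).congr_deriv ?_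
    field_simp
    linear_combination Real.sin_sq_add_cos_sq (θ / 2)

/-- A van der Corput type estimate for an amplitude `a` and a phase derivative `q` which vanish
at the endpoints of `[0, 2π]` to first and second order respectively. -/
lemma norm_integral_le_of_phase_bounds {a a' E : ℝ → ℂ} {q q' : ℝ → ℝ} {c C n δ : ℝ}
    (hc : 0 < c) (hC : 0 ≤ C) (hn : 0 < n) (hδ : 0 < δ) (hδπ : δ ≤ Real.pi)
    (ha : ∀ θ, HasDerivAt a (a' θ) θ) (ha' : Continuous a')
    (hq : ∀ θ, HasDerivAt q (q' θ) θ) (hq' : Continuous q')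
    (hE : ∀ θ, HasDerivAt E (Complex.I * q θ * E θ) θ) (hE1 : ∀ θ, ‖E θ‖ = 1)
    (ha_le : ∀ θ, ‖a θ‖ ≤ 4 * |Real.sin (θ / 2)|) (ha'_le : ∀ θ, ‖a' θ‖ ≤ 2)
    (hq'_le : ∀ θ, |q' θ| ≤ C * n * |Real.sin (θ / 2)|)
    (hq_ge : ∀ θ ∈ Set.Icc δ (2 * Real.pi - δ), c * n * Real.sin (θ / 2) ^ 2 ≤ |q θ|) :
    ‖∫ θ in (0 : ℝ)..2 * Real.pi, a θ * E θ‖ ≤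
      4 * δ ^ 2 + (8 * Real.pi / c + 4 * Real.pi * (2 / c + 4 * C / c ^ 2)) / (n * δ) := by
  have hπ := Real.pi_pos
  have hac : Continuous a := continuous_iff_continuousAt.2 fun θ => (ha θ).continuousAt
  have hqc : Continuous q := continuous_iff_continuousAt.2 fun θ => (hq θ).continuousAt
  have hEc : Continuous E := continuous_iff_continuousAt.2 fun θ => (hE θ).continuousAt
  have hint : ∀ x y, IntervalIntegrable (fun θ => a θ * E θ) MeasureTheory.volume x y :=
    fun x y => (hac.mul hEc).intervalIntegrable x y
  have hle : δ ≤ 2 * Real.pi - δ := by linarith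
  have hs : ∀ θ ∈ Set.Icc δ (2 * Real.pi - δ), δ / Real.pi ≤ Real.sin (θ / 2) :=
    fun θ hθ => div_pi_le_sin_half hδ.le hθ.1 hθ.2
  have hδπ0 : 0 < δ / Real.pi := div_pos hδ hπ
  have hs0 : ∀ θ ∈ Set.Icc δ (2 * Real.pi - δ), 0 < Real.sin (θ / 2) :=
    fun θ hθ => hδπ0.trans_le (hs θ hθ)
  have hqpos : ∀ θ ∈ Set.Icc δ (2 * Real.pi - δ), 0 < |q θ| := fun θ hθ =>
    lt_of_lt_of_le (by have := hs0 θ hθ; positivity) (hq_ge θ hθ)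
  have hq0 : ∀ θ ∈ Set.Icc δ (2 * Real.pi - δ), (q θ : ℂ) ≠ 0 := fun θ hθ =>
    Complex.ofReal_ne_zero.2 (abs_pos.1 (hqpos θ hθ))
  have hleft : ‖∫ θ in (0 : ℝ)..δ, a θ * E θ‖ ≤ 2 * δ ^ 2 := by
    have := intervalIntegral.norm_integral_le_of_norm_le_const (a := 0) (b := δ)
      (f := fun θ => a θ * E θ) (C := 2 * δ) fun θ hθ => by
        rw [Set.uIoc_of_le hδ.le] at hθ
        rw [norm_mul, hE1, mul_one]
        have h := Real.abs_sin_le_abs (x := θ / 2)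
        rw [abs_of_pos (show 0 < θ / 2 by linarith [hθ.1])] at h
        linarith [ha_le θ, hθ.2]
    rw [sub_zero, abs_of_pos hδ] at this
    linarith
  have hright : ‖∫ θ in (2 * Real.pi - δ)..2 * Real.pi, a θ * E θ‖ ≤ 2 * δ ^ 2 := by
    have := intervalIntegral.norm_integral_le_of_norm_le_const (a := 2 * Real.pi - δ)
      (b := 2 * Real.pi) (f := fun θ => a θ * E θ) (C := 2 * δ) fun θ hθ => by
        rw [Set.uIoc_of_le (by linarith)] at hθ
        rw [norm_mul, hE1, mul_one]
        have h := Real.abs_sin_le_abs (x := Real.pi - θ / 2)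
        rw [Real.sin_pi_sub, abs_of_nonneg (show 0 ≤ Real.pi - θ / 2 by linarith [hθ.2])] at h
        linarith [ha_le θ, hθ.1]
    rw [show 2 * Real.pi - (2 * Real.pi - δ) = δ by ring, abs_of_pos hδ] at this
    linarith
  have hmid : ‖∫ θ in δ..(2 * Real.pi - δ), a θ * E θ‖ ≤
      (8 * Real.pi / c + 4 * Real.pi * (2 / c + 4 * C / c ^ 2)) / (n * δ) := by
    set u : ℝ → ℂ := fun θ => a θ / (Complex.I * q θ) with hu
    set u' : ℝ → ℂ := fun θ => (a' θ * (Complex.I * q θ) - a θ * (Complex.I * q' θ)) /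
      (Complex.I * q θ) ^ 2 with hu'
    have hII : Set.uIcc δ (2 * Real.pi - δ) = Set.Icc δ (2 * Real.pi - δ) := Set.uIcc_of_le hle
    have hIq : ∀ θ ∈ Set.Icc δ (2 * Real.pi - δ), Complex.I * (q θ : ℂ) ≠ 0 := fun θ hθ =>
      mul_ne_zero Complex.I_ne_zero (hq0 θ hθ)
    have hparts := intervalIntegral.integral_mul_deriv_eq_deriv_mul (a := δ)
      (b := 2 * Real.pi - δ) (u := u) (u' := u') (v := E) (v' := fun θ => Complex.I * q θ * E θ)
      (fun θ hθ => (ha θ).div ((hq θ).ofReal_comp.const_mul Complex.I) (hIq θ (hII ▸ hθ)))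
      (fun θ _ => hE θ)
      (ContinuousOn.intervalIntegrable (by
        rw [hII]
        refine ContinuousOn.div (by fun_prop) (by fun_prop) fun θ hθ => pow_ne_zero 2 (hIq θ hθ)))
      (Continuous.intervalIntegrable (by fun_prop) _ _)
    have hcongr : ∫ θ in δ..(2 * Real.pi - δ), a θ * E θ =
        ∫ θ in δ..(2 * Real.pi - δ), u θ * (Complex.I * q θ * E θ) := by
      refine intervalIntegral.integral_congr fun θ hθ => ?_
      rw [hII] at hθ
      have := hIq θ hθ
      simp only [hu]
      rw [← mul_assoc, div_mul_cancel₀ _ this]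
    have hbd : ∀ θ ∈ Set.Icc δ (2 * Real.pi - δ), ‖u θ * E θ‖ ≤ 4 * Real.pi / c / (n * δ) := by
      intro θ hθ
      have hsp := hs0 θ hθ
      have h1 := ha_le θ
      rw [abs_of_pos hsp] at h1
      simp only [hu, norm_mul, norm_div, hE1, Complex.norm_I, Complex.norm_real,
        Real.norm_eq_abs, one_mul, mul_one]
      calc ‖a θ‖ / |q θ| ≤ 4 * Real.sin (θ / 2) / (c * n * Real.sin (θ / 2) ^ 2) := by
            gcongr
            exact hq_ge θ hθ
        _ = 4 / (c * n * Real.sin (θ / 2)) := by field_simp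
        _ ≤ 4 / (c * n * (δ / Real.pi)) := by
            gcongr
            exact hs θ hθ
        _ = _ := by field_simp
    have hdI := integral_inv_sin_half_sq_le hδ hδπ
    have hder : ‖∫ θ in δ..(2 * Real.pi - δ), u' θ * E θ‖ ≤
        (2 / c + 4 * C / c ^ 2) / n * (4 * Real.pi / δ) := by
      calc _ ≤ ∫ θ in δ..(2 * Real.pi - δ), (2 / c + 4 * C / c ^ 2) / n *
            (1 / Real.sin (θ / 2) ^ 2) := by
            refine intervalIntegral.norm_integral_le_of_norm_le hle (.of_forall fun θ hθ' => ?_)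
              (hdI.1.const_mul _)
            have hθ := Set.Ioc_subset_Icc_self hθ'
            have hsp := hs0 θ hθ
            have h1 := ha_le θ
            have h2 := hq'_le θ
            have h3 := hqpos θ hθ
            rw [abs_of_pos hsp] at h1 h2
            rw [norm_mul, hE1, mul_one]
            simp only [hu', norm_div, norm_pow, norm_mul, Complex.norm_I, Complex.norm_real,
              Real.norm_eq_abs, one_mul]
            have h4 : ‖a' θ * (Complex.I * q θ) - a θ * (Complex.I * q' θ)‖ ≤
                2 * |q θ| + 4 * Real.sin (θ / 2) * (C * n * Real.sin (θ / 2)) := by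
              refine (norm_sub_le _ _).trans ?_
              simp only [norm_mul, Complex.norm_I, Complex.norm_real, Real.norm_eq_abs, one_mul]
              gcongr
              exact ha'_le θ
            calc _ ≤ (2 * |q θ| + 4 * Real.sin (θ / 2) * (C * n * Real.sin (θ / 2))) /
                  |q θ| ^ 2 := by gcongr
              _ = 2 / |q θ| + 4 * C * n * Real.sin (θ / 2) ^ 2 / |q θ| ^ 2 := by
                  field_simp
              _ ≤ 2 / (c * n * Real.sin (θ / 2) ^ 2) + 4 * C * n * Real.sin (θ / 2) ^ 2 /
                  (c * n * Real.sin (θ / 2) ^ 2) ^ 2 := by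
                  have := hq_ge θ hθ
                  gcongr
              _ = _ := by field_simp
        _ = (2 / c + 4 * C / c ^ 2) / n *
            ∫ θ in δ..(2 * Real.pi - δ), 1 / Real.sin (θ / 2) ^ 2 :=
            intervalIntegral.integral_const_mul _ _
        _ ≤ _ := by
            gcongr
            exact hdI.2
    rw [hcongr, hparts]
    have hsub := norm_sub_le (u (2 * Real.pi - δ) * E (2 * Real.pi - δ)) (u δ * E δ)
    refine (norm_sub_le _ _).trans ((add_le_add hsub hder).trans ?_)
    have e1 := hbd _ (Set.right_mem_Icc.2 hle)
    have e2 := hbd _ (Set.left_mem_Icc.2 hle)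
    calc _ ≤ 4 * Real.pi / c / (n * δ) + 4 * Real.pi / c / (n * δ) +
          (2 / c + 4 * C / c ^ 2) / n * (4 * Real.pi / δ) := by gcongr
      _ = _ := by field_simp; ring
  rw [← intervalIntegral.integral_add_adjacent_intervals (hint 0 (2 * Real.pi - δ)) (hint _ _),
    ← intervalIntegral.integral_add_adjacent_intervals (hint 0 δ) (hint _ _)]
  refine (norm_add₃_le).trans ?_
  linarith

lemma abs_sin_le_two_mul_abs_sin_half (θ : ℝ) : |Real.sin θ| ≤ 2 * |Real.sin (θ / 2)| := by
  have : Real.sin θ = 2 * Real.sin (θ / 2) * Real.cos (θ / 2) := by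
    rw [← Real.sin_two_mul]; ring_nf
  rw [this, abs_mul, abs_mul, abs_two]
  exact mul_le_of_le_one_right (by positivity) (Real.abs_cos_le_one _)

section Blaschke

variable {μ : ℝ}

lemma sq_one_sub_abs_le (μ θ : ℝ) : (1 - |μ|) ^ 2 ≤ 1 + μ ^ 2 - 2 * μ * Real.cos θ := by
  have h : μ * Real.cos θ ≤ |μ| := (le_abs_self _).trans (by
    rw [abs_mul]
    exact mul_le_of_le_one_right (abs_nonneg _) (Real.abs_cos_le_one θ))
  nlinarith [sq_abs μ]

lemma one_add_sq_sub_cos_pos (hμ : |μ| < 1) (θ : ℝ) : 0 < 1 + μ ^ 2 - 2 * μ * Real.cos θ :=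
  (pow_pos (sub_pos.2 hμ) 2).trans_le (sq_one_sub_abs_le μ θ)

lemma one_sub_mul_ne_zero (hμ : |μ| < 1) {z : ℂ} (hz : ‖z‖ ≤ 1) : 1 - (μ : ℂ) * z ≠ 0 := by
  intro h
  have h1 : ‖(μ : ℂ) * z‖ = 1 := by rw [← sub_eq_zero.1 h, norm_one]
  rw [norm_mul, Complex.norm_real, Real.norm_eq_abs] at h1
  nlinarith [abs_nonneg μ, norm_nonneg z]

lemma exp_sub_mul_one_sub_mul_exp (μ θ : ℝ) :
    (Complex.exp (θ * Complex.I) - μ) * (1 - μ * Complex.exp (θ * Complex.I)) =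
      Complex.exp (θ * Complex.I) * ((1 + μ ^ 2 - 2 * μ * Real.cos θ : ℝ) : ℂ) := by
  push_cast
  rw [Complex.cos, neg_mul, Complex.exp_neg]
  have := Complex.exp_ne_zero (θ * Complex.I)
  field_simp
  ring

lemma norm_exp_sub_eq (μ θ : ℝ) :
    ‖Complex.exp (θ * Complex.I) - μ‖ = ‖1 - μ * Complex.exp (θ * Complex.I)‖ := by
  rw [← Complex.norm_conj (1 - _)]
  simp only [map_sub, map_one, map_mul, Complex.conj_ofReal, ← Complex.exp_conj, Complex.conj_I]
  rw [mul_neg, Complex.exp_neg]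
  have h := Complex.exp_ne_zero (θ * Complex.I)
  have e : Complex.exp (θ * Complex.I) - μ =
      Complex.exp (θ * Complex.I) * (1 - μ * (Complex.exp (θ * Complex.I))⁻¹) := by
    field_simp
  rw [e, norm_mul, Complex.norm_exp_ofReal_mul_I, one_mul]

lemma hasDerivAt_exp_mul_I (θ : ℝ) :
    HasDerivAt (fun θ : ℝ => Complex.exp (θ * Complex.I))
      (Complex.I * Complex.exp (θ * Complex.I)) θ := by
  have h := (((hasDerivAt_id θ).ofReal_comp).mul_const Complex.I).cexp
  refine h.congr_deriv ?_
  simp [mul_comm]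

lemma hasDerivAt_blaschke_pow_mul_exp (hμ : |μ| < 1) {n : ℕ} (hn : n ≠ 0) (k : ℕ) (θ : ℝ) :
    HasDerivAt (fun θ : ℝ => ((Complex.exp (θ * Complex.I) - μ) /
        (1 - μ * Complex.exp (θ * Complex.I))) ^ n * Complex.exp (-(k * (θ * Complex.I))))
      (Complex.I * ((n * ((1 - μ ^ 2) / (1 + μ ^ 2 - 2 * μ * Real.cos θ)) - k : ℝ) : ℂ) *
        (((Complex.exp (θ * Complex.I) - μ) / (1 - μ * Complex.exp (θ * Complex.I))) ^ n *
          Complex.exp (-(k * (θ * Complex.I))))) θ := by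
  have hw := hasDerivAt_exp_mul_I θ
  have hD := one_add_sq_sub_cos_pos hμ θ
  have hfac := exp_sub_mul_one_sub_mul_exp μ θ
  have hnz : 1 - (μ : ℂ) * Complex.exp (θ * Complex.I) ≠ 0 :=
    one_sub_mul_ne_zero hμ (Complex.norm_exp_ofReal_mul_I θ).le
  have hB := (hw.sub_const (μ : ℂ)).div ((hw.const_mul (μ : ℂ)).const_sub 1) hnz
  have hlin : HasDerivAt (fun θ : ℝ => -((k : ℂ) * (θ * Complex.I))) (-(k * Complex.I)) θ := by
    have := ((((hasDerivAt_id θ).ofReal_comp).mul_const Complex.I).const_mul (k : ℂ)).neg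
    refine this.congr_deriv ?_
    simp
  refine ((hB.pow n).mul hlin.cexp).congr_deriv ?_
  obtain ⟨m, rfl⟩ := Nat.exists_eq_succ_of_ne_zero hn
  simp only [Pi.div_apply, Pi.pow_apply]
  generalize 1 + μ ^ 2 - 2 * μ * Real.cos θ = D at hD hfac ⊢
  have hDc : (D : ℂ) ≠ 0 := Complex.ofReal_ne_zero.2 hD.ne'
  push_cast
  generalize Complex.exp (-(k * (θ * Complex.I))) = e
  generalize Complex.exp (θ * Complex.I) = w at hnz hfac ⊢
  have hB' : (w - μ) / (1 - μ * w) = w * D / (1 - μ * w) ^ 2 := by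
    rw [← hfac]
    field_simp
  have hder : (Complex.I * w * (1 - μ * w) - (w - μ) * -(μ * (Complex.I * w))) / (1 - μ * w) ^ 2 =
      Complex.I * ((1 - (μ : ℂ) ^ 2) / D) * ((w - μ) / (1 - μ * w)) := by
    rw [hB']
    field_simp
    ring
  rw [hder]
  simp only [Nat.succ_eq_add_one, pow_succ _ m]
  ring

lemma norm_one_sub_exp_sq_le (θ : ℝ) :
    ‖1 - Complex.exp (θ * Complex.I) ^ 2‖ ≤ 4 * |Real.sin (θ / 2)| := by
  have e : 1 - Complex.exp (θ * Complex.I) ^ 2 =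
      -2 * Complex.I * Complex.exp (θ * Complex.I) * (Real.sin θ : ℂ) := by
    push_cast
    rw [Complex.sin, neg_mul (θ : ℂ), Complex.exp_neg]
    have := Complex.exp_ne_zero (θ * Complex.I)
    field_simp
    rw [Complex.I_sq]
    ring
  have hsin := abs_sin_le_two_mul_abs_sin_half θ
  rw [e, norm_mul, norm_mul, norm_mul, Complex.norm_exp_ofReal_mul_I, Complex.norm_I,
    Complex.norm_real, Real.norm_eq_abs]
  norm_num
  linarith

/-- The phase derivative of the Blaschke factor has a nondegenerate maximum or minimum at `0`. -/
lemma le_abs_phase_deriv_sub (hμ : |μ| < 1) (θ : ℝ) :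
    |μ| * (1 + μ) / (1 - μ) * Real.sin (θ / 2) ^ 2 ≤
      |(1 - μ ^ 2) / (1 + μ ^ 2 - 2 * μ * Real.cos θ) - (1 + μ) / (1 - μ)| := by
  obtain ⟨h1, h2⟩ := abs_lt.1 hμ
  have hD := one_add_sq_sub_cos_pos hμ θ
  have hD4 : 1 + μ ^ 2 - 2 * μ * Real.cos θ ≤ 4 := by
    have := abs_le.1 (Real.abs_cos_le_one θ)
    nlinarith
  have hcos : Real.cos θ = 1 - 2 * Real.sin (θ / 2) ^ 2 := by
    have := Real.cos_two_mul (θ / 2)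
    rw [mul_div_cancel₀ _ two_ne_zero] at this
    linarith [Real.sin_sq_add_cos_sq (θ / 2)]
  have hm : 0 < 1 - μ := by linarith
  have hp : 0 < 1 + μ := by linarith
  have e : (1 - μ ^ 2) / (1 + μ ^ 2 - 2 * μ * Real.cos θ) - (1 + μ) / (1 - μ) =
      -(μ * ((1 + μ) / (1 - μ) * (4 * Real.sin (θ / 2) ^ 2) /
        (1 + μ ^ 2 - 2 * μ * Real.cos θ))) := by
    have hDs : 1 + μ ^ 2 - 2 * μ * Real.cos θ = (1 - μ) ^ 2 + 4 * μ * Real.sin (θ / 2) ^ 2 := by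
      rw [hcos]
      ring
    generalize 1 + μ ^ 2 - 2 * μ * Real.cos θ = D at hD hDs ⊢
    field_simp
    rw [hDs]
    ring
  rw [e, abs_neg, abs_mul, abs_of_nonneg (a := (1 + μ) / (1 - μ) * _ / _) (by positivity),
    mul_div_assoc, mul_assoc]
  gcongr
  rw [le_div_iff₀ hD]
  have : 0 ≤ (1 + μ) / (1 - μ) * Real.sin (θ / 2) ^ 2 := by positivity
  nlinarith

lemma hasDerivAt_phase_deriv (hμ : |μ| < 1) (n k θ : ℝ) :
    HasDerivAt (fun θ => n * ((1 - μ ^ 2) / (1 + μ ^ 2 - 2 * μ * Real.cos θ)) - k)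
      (n * (-((1 - μ ^ 2) * (2 * μ * Real.sin θ)) / (1 + μ ^ 2 - 2 * μ * Real.cos θ) ^ 2)) θ := by
  have hD := one_add_sq_sub_cos_pos hμ θ
  have h := ((((hasDerivAt_const θ (1 - μ ^ 2)).div
    (((Real.hasDerivAt_cos θ).const_mul (2 * μ)).const_sub (1 + μ ^ 2)) hD.ne').const_mul
      n).sub_const k)
  refine h.congr_deriv ?_
  ring

lemma abs_phase_second_deriv_le (hμ : |μ| < 1) {n : ℝ} (hn : 0 ≤ n) (θ : ℝ) :
    |n * (-((1 - μ ^ 2) * (2 * μ * Real.sin θ)) / (1 + μ ^ 2 - 2 * μ * Real.cos θ) ^ 2)| ≤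
      4 / (1 - |μ|) ^ 4 * n * |Real.sin (θ / 2)| := by
  have hD := sq_one_sub_abs_le μ θ
  have hm : 0 < 1 - |μ| := sub_pos.2 hμ
  have hsin := abs_sin_le_two_mul_abs_sin_half θ
  have hsq : |1 - μ ^ 2| ≤ 1 := by
    rw [abs_le]; constructor <;> nlinarith [sq_abs μ, abs_nonneg μ]
  rw [abs_mul, abs_div, abs_neg, abs_mul, abs_mul, abs_mul, abs_two, abs_of_nonneg hn,
    abs_of_nonneg (a := (1 + μ ^ 2 - 2 * μ * Real.cos θ) ^ 2) (sq_nonneg _)]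
  calc _ ≤ n * (1 * (2 * 1 * (2 * |Real.sin (θ / 2)|)) / ((1 - |μ|) ^ 2) ^ 2) := by gcongr
    _ = _ := by field_simp; ring

/-- The bound for the coefficients near the critical ratio `(1 + μ) / (1 - μ)`, at which the
degenerate stationary point of the phase is `z = 1`. -/
lemma exists_coeff_bound_near_critical_ratio (hμ : |μ| < 1) (hμ0 : μ ≠ 0) {a : ℕ → ℕ → ℂ}
    (ha : ∀ n : ℕ, 1 ≤ n → ∀ z : ℂ, ‖z‖ < 1 → HasSum (fun k => a n k * z ^ k)
      ((1 - z ^ 2) * ((z - (μ : ℂ)) / (1 - (μ : ℂ) * z)) ^ n)) :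
    ∃ M : ℝ, 0 < M ∧ ∃ N : ℕ, ∀ n : ℕ, N ≤ n → ∀ k : ℕ,
      |(k : ℝ) / n - (1 + μ) / (1 - μ)| ≤ (n : ℝ) ^ (-(2 : ℝ) / 3) →
      ‖a n k‖ ≤ M * (n : ℝ) ^ (-(2 : ℝ) / 3) := by
  obtain ⟨h1, h2⟩ := abs_lt.1 hμ
  have hπ := Real.pi_pos
  have hm : 0 < 1 - μ := by linarith
  have hp : 0 < 1 + μ := by linarith
  have hm' : 0 < 1 - |μ| := sub_pos.2 hμ
  have hμpos : 0 < |μ| := abs_pos.2 hμ0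
  obtain ⟨c, hc⟩ : ∃ c, c = |μ| * (1 + μ) / (1 - μ) / 2 := ⟨_, rfl⟩
  obtain ⟨C, hC⟩ : ∃ C, C = 4 / (1 - |μ|) ^ 4 := ⟨_, rfl⟩
  have hc0 : 0 < c := by rw [hc]; positivity
  have hC0 : 0 < C := by rw [hC]; positivity
  obtain ⟨K, hK⟩ : ∃ K, K = Real.pi * (1 + 1 / c) := ⟨_, rfl⟩
  have hK0 : 0 < K := by rw [hK]; positivity
  refine ⟨4 * K ^ 2 + (8 * Real.pi / c + 4 * Real.pi * (2 / c + 4 * C / c ^ 2)) / K,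
    by positivity, ⌈K ^ 3⌉₊ + 1, fun n hn k hk => ?_⟩
  have hn1 : 1 ≤ n := by omega
  have hn0 : (0 : ℝ) < n := by exact_mod_cast hn1
  have hKn : K ^ 3 ≤ n := (Nat.le_ceil _).trans (by exact_mod_cast (by omega : ⌈K ^ 3⌉₊ ≤ n))
  obtain ⟨r, hr⟩ : ∃ r, r = (n : ℝ) ^ (-(1 : ℝ) / 3) := ⟨_, rfl⟩
  have hr0 : 0 < r := by rw [hr]; positivity
  have hr2 : (n : ℝ) ^ (-(2 : ℝ) / 3) = r ^ 2 := by
    rw [hr, ← Real.rpow_natCast, ← Real.rpow_mul hn0.le]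
    norm_num
  have hr3 : n * r ^ 3 = 1 := by
    rw [hr, ← Real.rpow_natCast, ← Real.rpow_mul hn0.le]
    norm_num
    rw [Real.rpow_neg_one, mul_inv_cancel₀ hn0.ne']
  have hKr : K * r ≤ 1 := by
    refine le_of_pow_le_pow_left₀ three_ne_zero zero_le_one ?_
    calc (K * r) ^ 3 = K ^ 3 * r ^ 3 := by ring
      _ ≤ n * r ^ 3 := by gcongr
      _ = 1 ^ 3 := by rw [hr3, one_pow]
  rw [hr2] at hk ⊢
  have hδπ : K * r ≤ Real.pi := hKr.trans (by linarith [Real.pi_gt_three])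
  have hF : DifferentiableOn ℂ
      (fun z : ℂ => (1 - z ^ 2) * ((z - (μ : ℂ)) / (1 - (μ : ℂ) * z)) ^ n)
      (Metric.closedBall 0 1) := by
    refine DifferentiableOn.mul (by fun_prop) (DifferentiableOn.pow
      (DifferentiableOn.div (by fun_prop) (by fun_prop) fun z hz => ?_) n)
    exact one_sub_mul_ne_zero hμ (by simpa using hz)
  refine (norm_coeff_le_norm_integral hF (ha n hn1) k).trans ?_
  simp only [mul_assoc (1 - _ ^ 2 : ℂ)]
  refine (norm_integral_le_of_phase_bounds (c := c) (C := C) (n := n) (δ := K * r)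
    (a' := fun θ : ℝ => -(2 * Complex.I * Complex.exp (θ * Complex.I) ^ 2))
    hc0 hC0.le hn0 (by positivity) hδπ (fun θ => ?_) (by fun_prop)
    (fun θ => hasDerivAt_phase_deriv hμ n k θ) ?_
    (fun θ => hasDerivAt_blaschke_pow_mul_exp hμ (by omega) k θ) (fun θ => ?_)
    norm_one_sub_exp_sq_le (fun θ => ?_)
    (fun θ => hC ▸ abs_phase_second_deriv_le hμ hn0.le θ) (fun θ hθ => ?_)).trans_eq ?_
  · refine (((hasDerivAt_exp_mul_I θ).pow 2).const_sub 1).congr_deriv ?_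
    simp
    ring
  · have hD : ∀ θ : ℝ, (1 + μ ^ 2 - 2 * μ * Real.cos θ) ^ 2 ≠ 0 := fun θ =>
      pow_ne_zero 2 (one_add_sq_sub_cos_pos hμ θ).ne'
    exact continuous_const.mul (Continuous.div (by fun_prop) (by fun_prop) hD)
  · have hne : ‖1 - (μ : ℂ) * Complex.exp (θ * Complex.I)‖ ≠ 0 := norm_ne_zero_iff.2
      (one_sub_mul_ne_zero hμ (Complex.norm_exp_ofReal_mul_I θ).le)
    have he : ‖Complex.exp (-(k * (θ * Complex.I)))‖ = 1 := by
      rw [show -((k : ℂ) * (θ * Complex.I)) = ((-(k * θ) : ℝ) : ℂ) * Complex.I by push_cast; ring]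
      exact Complex.norm_exp_ofReal_mul_I _
    rw [norm_mul, norm_pow, norm_div, norm_exp_sub_eq, div_self hne, one_pow, he, one_mul]
  · rw [norm_neg, norm_mul, norm_pow, Complex.norm_exp_ofReal_mul_I]
    simp
  · have hs := div_pi_le_sin_half (by positivity) hθ.1 hθ.2
    have hcs : r ^ 2 ≤ c * Real.sin (θ / 2) ^ 2 := by
      calc r ^ 2 = 1 * r ^ 2 := (one_mul _).symm
        _ ≤ c * (1 + 1 / c) ^ 2 * r ^ 2 := by
            gcongr
            have : c * (1 + 1 / c) ^ 2 = c + 2 + 1 / c := by field_simp; ring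
            have : 0 < 1 / c := by positivity
            linarith
        _ = c * (K * r / Real.pi) ^ 2 := by rw [hK]; field_simp
        _ ≤ _ := by gcongr
    have hP := le_abs_phase_deriv_sub hμ θ
    rw [show |μ| * (1 + μ) / (1 - μ) = 2 * c by rw [hc]; ring] at hP
    set P := (1 - μ ^ 2) / (1 + μ ^ 2 - 2 * μ * Real.cos θ)
    have htri : |P - (1 + μ) / (1 - μ)| ≤ |P - k / n| + |(k : ℝ) / n - (1 + μ) / (1 - μ)| :=
      abs_sub_le _ _ _
    have hq : |n * P - k| = n * |P - k / n| := by
      rw [← abs_of_pos hn0, ← abs_mul, abs_of_pos hn0]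
      congr 1
      field_simp
    rw [hq]
    have : c * Real.sin (θ / 2) ^ 2 ≤ |P - k / n| := by linarith
    nlinarith
  · have : (1 : ℝ) / (n * (K * r)) = r ^ 2 / K := by
      field_simp
      linarith
    rw [div_eq_mul_one_div _ ((n : ℝ) * (K * r)), this]
    ring

end Blaschke

/-- Near the critical ratios k/n ≈ α₀ and k/n ≈ α₀^{−1} (within n^{−2/3}),
the Taylor coefficients c_{n,k} of F_n(z) = (1−z²)·((z−λ)/(1−λz))ⁿ satisfy
|c_{n,k}| ≤ M·n^{−2/3}. -/
theorem coeff_bound_critical_regions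
    (lam : ℝ) (hlam : lam ∈ Set.Ioo (0 : ℝ) 1)
    (alpha0 : ℝ) (halpha0 : alpha0 = (1 - lam) / (1 + lam))
    (c : ℕ → ℕ → ℂ)
    (hc : ∀ n : ℕ, 1 ≤ n → ∀ z : ℂ, ‖z‖ < 1 →
      Summable (fun k : ℕ => c n k * z ^ k) ∧
      ∑' k : ℕ, c n k * z ^ k =
        (1 - z ^ 2) * ((z - (lam : ℂ)) / (1 - (lam : ℂ) * z)) ^ n) :
    ∃ M : ℝ, 0 < M ∧ ∃ N : ℕ, ∀ n : ℕ, N ≤ n → ∀ k : ℕ,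
      (|(k : ℝ) / n - alpha0| ≤ (n : ℝ) ^ (-(2 : ℝ) / 3) ∨
        |(k : ℝ) / n - alpha0⁻¹| ≤ (n : ℝ) ^ (-(2 : ℝ) / 3)) →
      ‖c n k‖ ≤ M * (n : ℝ) ^ (-(2 : ℝ) / 3) := by
  obtain ⟨h0, h1⟩ := hlam
  have hsum : ∀ n : ℕ, 1 ≤ n → ∀ z : ℂ, ‖z‖ < 1 → HasSum (fun k => c n k * z ^ k)
      ((1 - z ^ 2) * ((z - (lam : ℂ)) / (1 - (lam : ℂ) * z)) ^ n) := fun n hn z hz =>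
    (hc n hn z hz).2 ▸ (hc n hn z hz).1.hasSum
  have habs : |lam| < 1 := by rwa [abs_of_pos h0]
  obtain ⟨M₁, hM₁, N₁, hN₁⟩ := exists_coeff_bound_near_critical_ratio habs h0.ne' hsum
  obtain ⟨M₂, hM₂, N₂, hN₂⟩ := exists_coeff_bound_near_critical_ratio (μ := -lam)
    (a := fun n k => (-1) ^ n * ((-1) ^ k * c n k)) (by rwa [abs_neg]) (neg_ne_zero.2 h0.ne')
    (fun n hn z hz => by
      have h := (hsum n hn (-z) (by rwa [norm_neg])).mul_left ((-1) ^ n)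
      have e : (fun k => (-1) ^ n * ((-1) ^ k * c n k) * z ^ k) =
          fun k => (-1) ^ n * (c n k * (-z) ^ k) := by
        funext k
        rw [neg_pow z]
        ring
      have e' : (1 - z ^ 2) * ((z - ((-lam : ℝ) : ℂ)) / (1 - ((-lam : ℝ) : ℂ) * z)) ^ n =
          (-1) ^ n * ((1 - (-z) ^ 2) * ((-z - lam) / (1 - lam * -z)) ^ n) := by
        rw [mul_left_comm, ← mul_pow]
        push_cast
        ring_nf
      rw [e, e']
      exact h)
  refine ⟨M₁ + M₂, by positivity, max N₁ N₂, fun n hn k hk => ?_⟩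
  have hr : 0 ≤ (n : ℝ) ^ (-(2 : ℝ) / 3) := by positivity
  rcases hk with hk | hk
  · have h := hN₂ n (le_of_max_le_right hn) k (by
      rw [← sub_eq_add_neg, sub_neg_eq_add, ← halpha0]
      exact hk)
    simp only [norm_mul, norm_pow, norm_neg, norm_one, one_pow, one_mul] at h
    nlinarith
  · have h := hN₁ n (le_of_max_le_left hn) k (by
      rw [halpha0, inv_div] at hk
      exact hk)
    nlinarith
end

section
/- (Schäffer's inequality.) Let n ≥ 1, let ‖·‖ be the operator norm on n×n complex matrices induced by an arbitrary norm on ℂⁿ, and let T be an invertible n×n complex matrix. Then |det T| · ‖T⁻¹‖ ≤ √(e·n) · ‖T‖^{n−1}, where e is Euler's number. -/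
/-- Multiplying a power series by a Blaschke factor `(z - a) / (1 - conj a * z)` does not increase
the partial sums of the squared moduli of its coefficients. -/
theorem exists_blaschke_factor_mul (a : ℂ) (ha : ‖a‖ ≤ 1) (f : ℕ → ℂ) :
    ∃ g : ℕ → ℂ, g 0 = -a * f 0 ∧
      (∀ k, g (k + 1) - star a * g k = f k - a * f (k + 1)) ∧
      ∀ N, ∑ k ∈ Finset.range N, ‖g k‖ ^ 2 ≤ ∑ k ∈ Finset.range N, ‖f k‖ ^ 2 := by
  let u : ℕ → ℂ := fun k => Nat.rec (f 0) (fun k uk => f (k + 1) + star a * uk) k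
  have hu0 : u 0 = f 0 := rfl
  have hu (k : ℕ) : u (k + 1) = f (k + 1) + star a * u k := rfl
  let g : ℕ → ℂ := fun k => Nat.casesOn k (-a * u 0) (fun k => u k - a * u (k + 1))
  have hg0 : g 0 = -a * u 0 := rfl
  have hg (k : ℕ) : g (k + 1) = u k - a * u (k + 1) := rfl
  have key (N : ℕ) : ∑ k ∈ Finset.range (N + 1), ‖g k‖ ^ 2 + (1 - ‖a‖ ^ 2) * ‖u N‖ ^ 2 =
      ∑ k ∈ Finset.range (N + 1), ‖f k‖ ^ 2 := by
    induction N with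
    | zero => simp [hg0, hu0]; ring
    | succ N ih =>
      rw [Finset.sum_range_succ, Finset.sum_range_succ (fun k => ‖f k‖ ^ 2), ← ih, hg]
      have hf : f (N + 1) = u (N + 1) - star a * u N := by rw [hu]; ring
      rw [hf]
      simp only [← Complex.normSq_eq_norm_sq, Complex.normSq_apply, Complex.sub_re, Complex.sub_im,
        Complex.mul_re, Complex.mul_im, Complex.star_def, Complex.conj_re, Complex.conj_im]
      ring
  refine ⟨g, by rw [hg0, hu0], fun k => ?_, fun N => ?_⟩
  · cases k with
    | zero => rw [hg, hg0, hu, hu0]; ring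
    | succ k => rw [hg (k + 1), hg k, hu (k + 1), hu k]; ring
  · cases N with
    | zero => simp
    | succ N =>
      rw [← key N]
      have : 0 ≤ 1 - ‖a‖ ^ 2 := by nlinarith [norm_nonneg a]
      linarith [mul_nonneg this (sq_nonneg ‖u N‖)]

section NormedAlgebra

variable {𝔸 : Type*} [NormedRing 𝔸] [NormOneClass 𝔸] [NormedAlgebra ℂ 𝔸]

theorem norm_le_one_of_sum_sq_le_one {f : ℕ → ℂ}
    (hf : ∀ N, ∑ k ∈ Finset.range N, ‖f k‖ ^ 2 ≤ 1) (k : ℕ) : ‖f k‖ ≤ 1 := by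
  have h1 := hf (k + 1)
  rw [Finset.sum_range_succ] at h1
  have h2 : 0 ≤ ∑ k ∈ Finset.range k, ‖f k‖ ^ 2 := Finset.sum_nonneg fun _ _ => by positivity
  exact (sq_le_one_iff₀ (norm_nonneg _)).1 (by linarith)

theorem norm_smul_pow_le (A : 𝔸) (c : ℂ) (k : ℕ) : ‖c • A ^ k‖ ≤ ‖c‖ * ‖A‖ ^ k := by
  rw [norm_smul]
  exact mul_le_mul_of_nonneg_left (norm_pow_le A k) (norm_nonneg _)

theorem summable_smul_pow_of_norm_le_one [CompleteSpace 𝔸] {A : 𝔸} (hA : ‖A‖ < 1) {f : ℕ → ℂ}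
    (hf : ∀ k, ‖f k‖ ≤ 1) : Summable fun k => f k • A ^ k := by
  refine Summable.of_norm_bounded (summable_geometric_of_lt_one (norm_nonneg A) hA) fun k => ?_
  exact (norm_smul_pow_le A (f k) k).trans
    (mul_le_of_le_one_left (pow_nonneg (norm_nonneg _) _) (hf k))

open Polynomial in
/-- A finite Blaschke product with zeros `s`, evaluated at a strict contraction `A`. -/
theorem exists_blaschke_product [CompleteSpace 𝔸] {A : 𝔸} (hA : ‖A‖ < 1) (s : Multiset ℂ)
    (hs : ∀ a ∈ s, ‖a‖ < 1) :
    ∃ f : ℕ → ℂ, f 0 = (s.map fun a => -a).prod ∧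
      (∀ N, ∑ k ∈ Finset.range N, ‖f k‖ ^ 2 ≤ 1) ∧
      ∃ q : ℂ[X], IsUnit (aeval A q) ∧
        aeval A q * ∑' k, f k • A ^ k = aeval A (s.map fun a => X - C a).prod := by
  induction s using Multiset.induction_on with
  | empty =>
    refine ⟨fun k => if k = 0 then 1 else 0, by simp, fun N => ?_, 1, by simp, ?_⟩
    · cases N <;> simp [apply_ite]
    · rw [tsum_eq_single 0 (by intro k hk; simp [hk])]
      simp
  | cons a s ih =>
    obtain ⟨f, hf0, hf, q, hq, hqf⟩ := ih fun b hb => hs b (Multiset.mem_cons_of_mem hb)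
    have ha : ‖a‖ < 1 := hs a (Multiset.mem_cons_self a s)
    obtain ⟨g, hg0, hg, hgf⟩ := exists_blaschke_factor_mul a ha.le f
    have hg1 (N : ℕ) := (hgf N).trans (hf N)
    have hsf := summable_smul_pow_of_norm_le_one hA (norm_le_one_of_sum_sq_le_one hf)
    have hsg := summable_smul_pow_of_norm_le_one hA (norm_le_one_of_sum_sq_le_one hg1)
    have hstep : (1 - star a • A) * ∑' k, g k • A ^ k
        = (A - algebraMap ℂ 𝔸 a) * ∑' k, f k • A ^ k := by
      have h1 : ∑' k, (g (k + 1) • A ^ (k + 1) - star a • (A * g k • A ^ k)) =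
          ∑' k, (A * f k • A ^ k - a • f (k + 1) • A ^ (k + 1)) := by
        congr 1
        ext1 k
        simp only [mul_smul_comm, ← pow_succ', smul_smul, ← sub_smul]
        rw [hg]
      rw [((summable_nat_add_iff 1).2 hsg).tsum_sub ((hsg.mul_left A).const_smul _),
        (hsf.mul_left A).tsum_sub (((summable_nat_add_iff 1).2 hsf).const_smul _),
        ((hsg.mul_left A)).tsum_const_smul, ((summable_nat_add_iff 1).2 hsf).tsum_const_smul,
        hsg.tsum_mul_left, hsf.tsum_mul_left] at h1
      have h2 := hsg.tsum_eq_zero_add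
      have h3 := hsf.tsum_eq_zero_add
      rw [← sub_eq_iff_eq_add'] at h2 h3
      rw [← h2, ← h3, hg0] at h1
      rw [sub_mul, sub_mul, one_mul, smul_mul_assoc, ← Algebra.smul_def]
      simp only [pow_zero, smul_sub, smul_smul, neg_mul, neg_smul] at h1
      rw [← sub_eq_zero] at h1 ⊢
      rw [← h1]
      abel
    have hden : aeval A (1 - C (star a) * X) = 1 - star a • A := by
      simp [Algebra.smul_def]
    refine ⟨g, by simp [hg0, hf0], hg1, (1 - C (star a) * X) * q, ?_, ?_⟩
    · rw [map_mul]
      refine IsUnit.mul ?_ hq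
      rw [hden]
      refine isUnit_one_sub_of_norm_lt_one ?_
      rw [norm_smul, norm_star]
      exact mul_lt_one_of_nonneg_of_lt_one_left (norm_nonneg _) ha hA.le
    · have h4 : aeval A (X - C a) = A - algebraMap ℂ 𝔸 a := by simp
      rw [mul_comm, map_mul, mul_assoc, hden, hstep, ← h4, ← mul_assoc, ← map_mul, mul_comm,
        map_mul, mul_assoc, hqf, ← map_mul, Multiset.map_cons, Multiset.prod_cons]

open Polynomial in
/-- If a strict contraction `A` is annihilated by a monic polynomial with zeros `s` in the open unit
disc, its inverse is bounded in terms of the product of `s`. -/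
theorem norm_prod_mul_norm_inverse_le [CompleteSpace 𝔸] {A B : 𝔸} (hA : ‖A‖ < 1) (hBA : B * A = 1)
    (s : Multiset ℂ) (hs : ∀ a ∈ s, ‖a‖ < 1)
    (hann : aeval A (s.map fun a => X - C a).prod = 0) :
    ‖(s.map fun a => -a).prod‖ * ‖B‖ ≤ √((1 - ‖A‖ ^ 2)⁻¹) := by
  obtain ⟨f, hf0, hf, q, hq, hqf⟩ := exists_blaschke_product hA s hs
  rw [hann, hq.mul_right_eq_zero] at hqf
  have hsf := summable_smul_pow_of_norm_le_one hA (norm_le_one_of_sum_sq_le_one hf)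
  have hst := summable_smul_pow_of_norm_le_one (f := fun k => f (k + 1)) hA
    fun k => norm_le_one_of_sum_sq_le_one hf (k + 1)
  have hB : f 0 • B = -∑' k, f (k + 1) • A ^ k := by
    rw [hsf.tsum_eq_zero_add, pow_zero] at hqf
    have h1 : ∑' k, f (k + 1) • A ^ (k + 1) = A * ∑' k, f (k + 1) • A ^ k := by
      rw [← hst.tsum_mul_left]
      simp only [mul_smul_comm, ← pow_succ']
    rw [h1] at hqf
    have h2 := congrArg (B * ·) hqf
    simp only [mul_add, ← mul_assoc, hBA, one_mul, mul_zero, mul_smul_comm, mul_one] at h2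
    exact eq_neg_of_add_eq_zero_left h2
  rw [← hf0, ← norm_smul, hB, norm_neg]
  refine le_of_tendsto hst.hasSum.tendsto_sum_nat.norm (Filter.Eventually.of_forall fun N => ?_)
  have hA2 : ‖A‖ ^ 2 < 1 := by nlinarith [norm_nonneg A]
  have hgeom : ∑ k ∈ Finset.range N, (‖A‖ ^ k) ^ 2 ≤ (1 - ‖A‖ ^ 2)⁻¹ := by
    simp only [← pow_mul, mul_comm _ 2]
    simp only [pow_mul]
    rw [← tsum_geometric_of_lt_one (by positivity) hA2]
    exact (summable_geometric_of_lt_one (by positivity) hA2).sum_le_tsum _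
      fun _ _ => by positivity
  have hfN : ∑ k ∈ Finset.range N, ‖f (k + 1)‖ ^ 2 ≤ 1 := by
    have h1 := hf (N + 1)
    rw [Finset.sum_range_succ'] at h1
    linarith [sq_nonneg ‖f 0‖]
  calc ‖∑ k ∈ Finset.range N, f (k + 1) • A ^ k‖
      ≤ ∑ k ∈ Finset.range N, ‖f (k + 1)‖ * ‖A‖ ^ k :=
        norm_sum_le_of_le _ fun k _ => norm_smul_pow_le A _ k
    _ ≤ √((1 - ‖A‖ ^ 2)⁻¹) := by
        refine Real.le_sqrt_of_sq_le ((Finset.sum_mul_sq_le_sq_mul_sq _ _ _).trans ?_)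
        calc _ ≤ 1 * (1 - ‖A‖ ^ 2)⁻¹ :=
              mul_le_mul hfN hgeom (Finset.sum_nonneg fun _ _ => by positivity) zero_le_one
          _ = _ := one_mul _

end NormedAlgebra

open Polynomial in
theorem norm_det_mul_norm_inverse_le_of_norm_lt_one
    {E : Type*} [NormedAddCommGroup E] [NormedSpace ℂ E] [FiniteDimensional ℂ E] [Nontrivial E]
    {A B : E →L[ℂ] E} (hA : ‖A‖ < 1) (hBA : B * A = 1) :
    ‖LinearMap.det (A : E →ₗ[ℂ] E)‖ * ‖B‖ ≤ √((1 - ‖A‖ ^ 2)⁻¹) := by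
  have : CompleteSpace E := FiniteDimensional.complete ℂ E
  set L : E →ₗ[ℂ] E := (A : E →ₗ[ℂ] E) with hL
  have hsplit : L.charpoly = (L.charpoly.roots.map fun a => X - C a).prod :=
    (IsAlgClosed.splits L.charpoly).eq_prod_roots_of_monic L.charpoly_monic
  have hdet : ‖LinearMap.det L‖ = ‖(L.charpoly.roots.map fun a => -a).prod‖ := by
    have h1 : L.charpoly.coeff 0 = (L.charpoly.roots.map fun a => -a).prod := by
      conv_lhs => rw [hsplit]
      rw [coeff_zero_eq_eval_zero, eval_multiset_prod, Multiset.map_map]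
      simp
    rw [← h1, LinearMap.det_eq_sign_charpoly_coeff]
    simp
  rw [hdet]
  refine norm_prod_mul_norm_inverse_le hA hBA _ (fun a ha => ?_) ?_
  · have hev : Module.End.HasEigenvalue L a := by
      rw [Module.End.hasEigenvalue_iff_isRoot_charpoly]
      exact (mem_roots'.1 ha).2
    obtain ⟨v, hv⟩ := hev.exists_hasEigenvector
    have h1 : A v = a • v := hv.apply_eq_smul
    have h2 := A.le_opNorm v
    rw [h1, norm_smul] at h2
    exact (le_of_mul_le_mul_right h2 (norm_pos_iff.2 hv.2)).trans_lt hA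
  · rw [← hsplit]
    apply ContinuousLinearMap.coe_injective
    have h := LinearMap.aeval_self_charpoly L
    let φ : (E →L[ℂ] E) →ₐ[ℂ] (E →ₗ[ℂ] E) :=
      { ContinuousLinearMap.toLinearMapRingHom with commutes' := fun _ => rfl }
    exact (aeval_algHom_apply φ A L.charpoly).symm.trans h

/-- Schäffer's inequality: For any norm on an n-dimensional complex space
(n ≥ 1) and any invertible operator T (with inverse S), the induced operator norms satisfy
|det T|·‖T⁻¹‖ ≤ √(e·n)·‖T‖^{n−1}. -/
theorem schaffer_inequality
    {E : Type*} [NormedAddCommGroup E] [NormedSpace ℂ E] [FiniteDimensional ℂ E]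
    (n : ℕ) (hn : 1 ≤ n) (hdim : Module.finrank ℂ E = n)
    (T S : E →L[ℂ] E) (hTS : T * S = 1) (hST : S * T = 1) :
    ‖LinearMap.det (T : E →ₗ[ℂ] E)‖ * ‖S‖ ≤
      Real.sqrt (Real.exp 1 * n) * ‖T‖ ^ (n - 1) := by
  have : Nontrivial E := Module.nontrivial_of_finrank_pos (R := ℂ) (by omega)
  have hT : 0 < ‖T‖ := norm_pos_iff.2 (left_ne_zero_of_mul_eq_one hTS)
  obtain ⟨m, rfl⟩ : ∃ m, n = m + 1 := ⟨n - 1, by omega⟩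
  set x : ℝ := ((m + 1 : ℕ) : ℝ) with hx
  have hx0 : 0 < x := by positivity
  set r : ℝ := √(x / (x + 1)) with hr
  have hr0 : 0 < r := by positivity
  have hr2 : r ^ 2 = x / (x + 1) := Real.sq_sqrt (by positivity)
  have hr1 : r < 1 := by
    have : x / (x + 1) < 1 := (div_lt_one (by positivity)).2 (by linarith)
    nlinarith
  set c : ℝ := r / ‖T‖ with hc
  have hc0 : 0 < c := by positivity
  have hcC : (c : ℂ) ≠ 0 := by exact_mod_cast hc0.ne'
  have hnc : ‖(c : ℂ)‖ = c := by simp [abs_of_pos hc0]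
  have hA : ‖(c : ℂ) • T‖ = r := by
    rw [norm_smul, hnc, hc]; field_simp
  have h := norm_det_mul_norm_inverse_le_of_norm_lt_one (A := (c : ℂ) • T) (B := (c : ℂ)⁻¹ • S)
    (by rw [hA]; exact hr1) (by rw [smul_mul_smul_comm, hST, inv_mul_cancel₀ hcC, one_smul])
  rw [hA, ContinuousLinearMap.toLinearMap_smul, LinearMap.det_smul, hdim, norm_smul, norm_mul,
    norm_pow, norm_inv, hnc] at h
  have h' : r ^ m * (‖LinearMap.det (T : E →ₗ[ℂ] E)‖ * ‖S‖) ≤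
      √((1 - r ^ 2)⁻¹) * ‖T‖ ^ m := by
    calc _ = (c ^ (m + 1) * ‖LinearMap.det (T : E →ₗ[ℂ] E)‖ * (c⁻¹ * ‖S‖)) * ‖T‖ ^ m := by
          have : r = c * ‖T‖ := by rw [hc]; field_simp
          rw [this, mul_pow, pow_succ]
          field_simp
      _ ≤ _ := mul_le_mul_of_nonneg_right h (by positivity)
  have hexp : √((1 - r ^ 2)⁻¹) ≤ r ^ m * √(Real.exp 1 * x) := by
    have h1 : (1 + 1 / x) ^ (m + 1) ≤ Real.exp 1 := by
      calc (1 + 1 / x) ^ (m + 1) ≤ Real.exp (1 / x) ^ (m + 1) :=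
            pow_le_pow_left₀ (by positivity) (by linarith [Real.add_one_le_exp (1 / x)]) _
        _ = Real.exp 1 := by
            rw [← Real.exp_nat_mul, ← hx, mul_one_div_cancel hx0.ne']
    refine Real.sqrt_le_iff.2 ⟨by positivity, ?_⟩
    rw [mul_pow, ← pow_mul, mul_comm m 2, pow_mul, hr2,
      Real.sq_sqrt (by positivity)]
    calc (1 - x / (x + 1))⁻¹ = (x / (x + 1)) ^ m * ((1 + 1 / x) ^ (m + 1) * x) := by
          have h2 : 1 + 1 / x = (x / (x + 1))⁻¹ := by field_simp
          have h3 : x / (x + 1) ≠ 0 := by positivity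
          have h4 : 1 - x / (x + 1) = 1 / (x + 1) := by field_simp; ring
          rw [h2, pow_succ, inv_pow, h4, ← mul_assoc, ← mul_assoc,
            mul_inv_cancel₀ (pow_ne_zero _ h3)]
          field_simp
      _ ≤ _ := by gcongr
  rw [Nat.add_sub_cancel]
  refine le_of_mul_le_mul_left (h'.trans ?_) (pow_pos hr0 m)
  rw [← mul_assoc]
  exact mul_le_mul_of_nonneg_right hexp (by positivity)
end
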